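/- Let R be a commutative ring, s ≥ 1, and let a_1, …, a_s ∈ R be such that a_1 + ⋯ + a_s is a unit of R. Set ξ = a_1 ẽ_1 + ⋯ + a_s ẽ_s ∈ Λ(R^s). Then for every c : {1, …, s} → R, if ξ ∧ (c_1 ẽ_1 + ⋯ + c_s ẽ_s) ∈ I_C(s), then there exists t ∈ R with c_α = t·a_α for all α. (Equivalently, the first cohomology of the Aomoto complex of the central arrangement C_s with respect to ξ vanishes: H¹(A_R(C_s), ξ) = 0.) -/

import Mathlib

noncomputable section

/-- The image `ẽ_i` of the `i`-th standard basis vector of `R^s` in `Λ(R^s)`. -/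
def gen (R : Type*) [CommRing R] (s : ℕ) (i : Fin s) :
    ExteriorAlgebra R (Fin s → R) :=
  ExteriorAlgebra.ι R (Pi.single i 1)

/-- Generators of the Orlik-Solomon ideal of the central arrangement `C_s` of `s`
lines through the origin in `ℂ²`. -/
def centralGens (R : Type*) [CommRing R] (s : ℕ) :
    Set (ExteriorAlgebra R (Fin s → R)) :=
  {x | ∃ α β γ : Fin s, α ≠ β ∧ α ≠ γ ∧ β ≠ γ ∧
        x = gen R s α * gen R s β - gen R s α * gen R s γ + gen R s β * gen R s γ}

/-- The Orlik-Solomon ideal `I_C(s)` of the central arrangement `C_s`. -/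
def centralIdeal (R : Type*) [CommRing R] (s : ℕ) :
    TwoSidedIdeal (ExteriorAlgebra R (Fin s → R)) :=
  TwoSidedIdeal.span (centralGens R s)

/-- For linear forms `σ` and `f`, the strictly upper triangular matrices `M v` with `(M v) ^ 2 = 0`
and `M u * M v` equal to `σ u * f v - f u * σ v` in the top right corner. -/
def nilpotentRep {R M : Type*} [CommRing R] [AddCommGroup M] [Module R M] (σ f : M →ₗ[R] R) :
    M →ₗ[R] Matrix (Fin 4) (Fin 4) R where
  toFun v := !![0, σ v, f v, 0; 0, 0, 0, f v; 0, 0, 0, -σ v; 0, 0, 0, 0]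
  map_add' u v := by
    ext i j
    fin_cases i <;> fin_cases j <;> simp [add_comm]
  map_smul' r v := by
    ext i j
    fin_cases i <;> fin_cases j <;> simp

theorem nilpotentRep_mul {R M : Type*} [CommRing R] [AddCommGroup M] [Module R M]
    (σ f : M →ₗ[R] R) (u v : M) :
    nilpotentRep σ f u * nilpotentRep σ f v =
      Matrix.single 0 3 (σ u * f v - f u * σ v) := by
  ext i j
  fin_cases i <;> fin_cases j <;>
    simp [nilpotentRep, Matrix.mul_apply, Fin.sum_univ_four, sub_eq_add_neg]

/-- The algebra homomorphism from the exterior algebra induced by `nilpotentRep`. -/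
def nilpotentHom {R M : Type*} [CommRing R] [AddCommGroup M] [Module R M] (σ f : M →ₗ[R] R) :
    ExteriorAlgebra R M →ₐ[R] Matrix (Fin 4) (Fin 4) R :=
  ExteriorAlgebra.lift R ⟨nilpotentRep σ f, fun v => by
    rw [nilpotentRep_mul, mul_comm, sub_self, Matrix.single_zero]⟩

theorem nilpotentHom_ι_mul_ι {R M : Type*} [CommRing R] [AddCommGroup M] [Module R M]
    (σ f : M →ₗ[R] R) (u v : M) :
    nilpotentHom σ f (ExteriorAlgebra.ι R u * ExteriorAlgebra.ι R v) =
      Matrix.single 0 3 (σ u * f v - f u * σ v) := by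
  rw [map_mul, nilpotentHom, ExteriorAlgebra.lift_ι_apply, ExteriorAlgebra.lift_ι_apply,
    nilpotentRep_mul]

theorem sum_smul_gen (R : Type*) [CommRing R] {s : ℕ} (a : Fin s → R) :
    ∑ α, a α • gen R s α = ExteriorAlgebra.ι R a := by
  simp only [gen, ← map_smul, ← map_sum]
  congr 1
  exact (pi_eq_sum_univ' a).symm

theorem nilpotentHom_eq_zero_of_mem_centralIdeal {R : Type*} [CommRing R] {s : ℕ}
    (σ f : (Fin s → R) →ₗ[R] R) (hσ : ∀ i, σ (Pi.single i 1) = 1)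
    {x : ExteriorAlgebra R (Fin s → R)} (hx : x ∈ centralIdeal R s) :
    nilpotentHom σ f x = 0 := by
  have hle : centralIdeal R s ≤ TwoSidedIdeal.ker (nilpotentHom σ f) := by
    refine TwoSidedIdeal.span_le.2 ?_
    rintro _ ⟨α, β, γ, -, -, -, rfl⟩
    rw [SetLike.mem_coe, TwoSidedIdeal.mem_ker]
    simp only [gen, map_add, map_sub, nilpotentHom_ι_mul_ι, hσ]
    ext i j
    simp only [Matrix.add_apply, Matrix.sub_apply, Matrix.single_apply, Matrix.zero_apply]
    split_ifs <;> ring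
  exact (TwoSidedIdeal.mem_ker _).1 (hle hx)

/-- Proposition 2.2 of the paper. If the coefficient sum of
`ξ = Σ a_α ẽ_α` is a unit, then the first Aomoto cohomology of the central
arrangement `C_s` vanishes: any `η = Σ c_α ẽ_α` with `ξ ∧ η ∈ I_C(s)` is a multiple
of `ξ`. -/
theorem central_aomoto_vanishing
    (R : Type*) [CommRing R] {s : ℕ} (hs : 1 ≤ s)
    (a : Fin s → R) (ha : IsUnit (∑ α, a α)) (c : Fin s → R)
    (hker : (∑ α, a α • gen R s α) * (∑ α, c α • gen R s α) ∈ centralIdeal R s) :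
    ∃ t : R, ∀ α, c α = t * a α := by
  obtain ⟨b, hb⟩ := ha.exists_left_inv
  refine ⟨b * ∑ β, c β, fun α => ?_⟩
  rw [sum_smul_gen, sum_smul_gen] at hker
  have h := nilpotentHom_eq_zero_of_mem_centralIdeal
    (∑ β, LinearMap.proj β) (LinearMap.proj α) (fun i => by simp) hker
  rw [nilpotentHom_ι_mul_ι] at h
  have h' := congrFun₂ h 0 3
  simp only [Matrix.single_apply_same, Matrix.zero_apply, LinearMap.sum_apply,
    LinearMap.proj_apply] at h'
  linear_combination b * h' - c α * hb
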